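/- arXiv:1110.1297 — 3 statements merged into one kernel-verified Lean document; each statement's English description precedes it below -/
import Mathlib

section
/- For every n ≥ 1 and every b ∈ F^{−n} with d♯(b) = 0, there exist l ∈ ℕ and β ∈ C such that λ^l·b − d♯(β) lies in F⁰ (and is again a d♯-cycle). -/
/-- The step `F^m` of the decreasing filtration associated with a ℤ-indexed family of submodules. -/
def gradingFiltration {R C : Type*} [Ring R] [AddCommGroup C] [Module R C]
    (𝒞 : ℤ → Submodule R C) (m : ℤ) : Submodule R C :=
  ⨆ j ≥ m, 𝒞 j

namespace gradingFiltration

section Ring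

variable {R C : Type*} [Ring R] [AddCommGroup C] [Module R C] {𝒞 : ℤ → Submodule R C}

theorem le_of_le {m j : ℤ} (h : m ≤ j) : 𝒞 j ≤ gradingFiltration 𝒞 m :=
  le_iSup₂_of_le j h le_rfl

theorem antitone : Antitone (gradingFiltration 𝒞) := fun _ _ h =>
  iSup₂_le fun _ hj => le_of_le (h.trans hj)

theorem le_sup_succ (m : ℤ) :
    gradingFiltration 𝒞 m ≤ 𝒞 m ⊔ gradingFiltration 𝒞 (m + 1) := by
  refine iSup₂_le fun j hj => ?_
  rcases eq_or_lt_of_le hj with rfl | h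
  · exact le_sup_left
  · exact le_sup_of_le_right (le_of_le h)

theorem disjoint_of_lt (hind : iSupIndep 𝒞) {i m : ℤ} (h : i < m) :
    Disjoint (𝒞 i) (gradingFiltration 𝒞 m) :=
  (hind i).mono_right (iSup₂_le fun j hj => le_iSup₂_of_le j (h.trans_le hj).ne' le_rfl)

/-- A map raising the grading by at least `k` raises the filtration by at least `k`. -/
theorem map_mem {f : C →ₗ[R] C} {k : ℤ}
    (hf : ∀ h, ∀ z ∈ 𝒞 h, f z ∈ gradingFiltration 𝒞 (h + k)) {m : ℤ} {z : C}
    (hz : z ∈ gradingFiltration 𝒞 m) : f z ∈ gradingFiltration 𝒞 (m + k) := by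
  have hle : gradingFiltration 𝒞 m ≤ (gradingFiltration 𝒞 (m + k)).comap f :=
    iSup₂_le fun j hj w hw => antitone (by lia) (hf j w hw)
  exact hle hz

end Ring

section CommRing

variable {R C : Type*} [CommRing R] [AddCommGroup C] [Module R C] {𝒞 : ℤ → Submodule R C}
  {d x : C →ₗ[R] C}

/-- If the leading `d`-homology in grading `m` is `t`-power torsion, then a cycle of `d + x` in
`F^m` can be moved into `F^(m+1)`, up to a power of `t` and a boundary. -/
theorem exists_pow_smul_sub_mem_succ (hind : iSupIndep 𝒞)
    (hd : ∀ h, ∀ z ∈ 𝒞 h, d z ∈ 𝒞 (h + 1))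
    (hx : ∀ h, ∀ z ∈ 𝒞 h, x z ∈ gradingFiltration 𝒞 (h + 2)) {t : R} {m : ℤ}
    (htor : ∀ z ∈ 𝒞 m, d z = 0 → ∃ (l : ℕ) (β : C), β ∈ 𝒞 (m - 1) ∧ t ^ l • z = d β)
    {b : C} (hb : b ∈ gradingFiltration 𝒞 m) (hcycle : (d + x) b = 0) :
    ∃ (l : ℕ) (β : C), t ^ l • b - (d + x) β ∈ gradingFiltration 𝒞 (m + 1) := by
  obtain ⟨b₀, hb₀, b₁, hb₁, rfl⟩ := Submodule.mem_sup.1 (le_sup_succ m hb)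
  have hdb₁ : d b₁ ∈ gradingFiltration 𝒞 (m + 2) :=
    antitone (by lia) (map_mem (fun h z hz => le_of_le le_rfl (hd h z hz)) hb₁)
  have hdb₀ : d b₀ = -(d b₁ + x (b₀ + b₁)) := by
    rw [LinearMap.add_apply, map_add d, add_assoc] at hcycle
    exact eq_neg_of_add_eq_zero_left hcycle
  have hzero : d b₀ = 0 := by
    refine Submodule.disjoint_def.1 (disjoint_of_lt hind (by lia : m + 1 < m + 2)) _
      (hd m b₀ hb₀) ?_
    rw [hdb₀]
    exact neg_mem (add_mem hdb₁ (map_mem hx hb))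
  obtain ⟨l, β, hβ, hlβ⟩ := htor b₀ hb₀ hzero
  refine ⟨l, β, ?_⟩
  have hrest : t ^ l • (b₀ + b₁) - (d + x) β = t ^ l • b₁ - x β := by
    rw [smul_add, hlβ, LinearMap.add_apply]
    abel
  rw [hrest]
  exact sub_mem (Submodule.smul_mem _ _ hb₁) (antitone (by lia) (hx _ β hβ))

theorem exists_pow_smul_sub_mem_zero (hind : iSupIndep 𝒞)
    (hd : ∀ h, ∀ z ∈ 𝒞 h, d z ∈ 𝒞 (h + 1))
    (hx : ∀ h, ∀ z ∈ 𝒞 h, x z ∈ gradingFiltration 𝒞 (h + 2))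
    (hsq : (d + x) ∘ₗ (d + x) = 0) {t : R}
    (htor : ∀ h < 0, ∀ z ∈ 𝒞 h, d z = 0 →
      ∃ (l : ℕ) (β : C), β ∈ 𝒞 (h - 1) ∧ t ^ l • z = d β)
    (n : ℕ) {b : C} (hb : b ∈ gradingFiltration 𝒞 (-n)) (hcycle : (d + x) b = 0) :
    ∃ (l : ℕ) (β : C), t ^ l • b - (d + x) β ∈ gradingFiltration 𝒞 0 := by
  induction n generalizing b with
  | zero => exact ⟨0, 0, by simpa using hb⟩
  | succ n ih =>
    obtain ⟨l, β, hβ⟩ :=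
      exists_pow_smul_sub_mem_succ hind hd hx (htor _ (by lia)) hb hcycle
    obtain ⟨l', β', hβ'⟩ := ih (antitone (by lia) hβ) (by
      rw [map_sub, map_smul, hcycle, smul_zero, ← LinearMap.comp_apply, hsq,
        LinearMap.zero_apply, sub_zero])
    refine ⟨l' + l, t ^ l' • β + β', ?_⟩
    rwa [map_add, map_smul, pow_add, mul_smul, ← sub_sub, ← smul_sub]

end CommRing

end gradingFiltration


/-- Let `C = ⊕ₕ Cₕ` be a ℤ-graded module over `R = ℚ[[λ]]`, `d` homogeneous of degree `+1`,
`x` raising the grading by at least `2`, `d♯ = d + x` with `d♯ ∘ d♯ = 0`, and suppose the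
`d`-homology in negative gradings is `λ`-power torsion.  Then for every `n ≥ 1` and every
`d♯`-cycle `b ∈ F^{-n}` there are `l ∈ ℕ` and `β ∈ C` with `λ^l·b - d♯(β) ∈ F⁰`
(and this element is again a `d♯`-cycle). -/
theorem cycle_moves_into_top_filtration_level
    {C : Type*} [AddCommGroup C] [Module (PowerSeries ℚ) C]
    (𝒞 : ℤ → Submodule (PowerSeries ℚ) C)
    (hinternal : DirectSum.IsInternal 𝒞)
    (d x : C →ₗ[PowerSeries ℚ] C)
    (hd : ∀ h : ℤ, ∀ z ∈ 𝒞 h, d z ∈ 𝒞 (h + 1))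
    (hx : ∀ h : ℤ, ∀ z ∈ 𝒞 h, x z ∈ ⨆ j ≥ h + 2, 𝒞 j)
    (hsq : (d + x) ∘ₗ (d + x) = 0)
    (htor : ∀ h : ℤ, h < 0 → ∀ z ∈ 𝒞 h, d z = 0 →
      ∃ (l : ℕ) (β : C), β ∈ 𝒞 (h - 1) ∧ (PowerSeries.X ^ l : PowerSeries ℚ) • z = d β)
    (n : ℕ) (hn : 1 ≤ n) (b : C)
    (hb : b ∈ ⨆ j ≥ -(n : ℤ), 𝒞 j)
    (hcycle : (d + x) b = 0) :
    ∃ (l : ℕ) (β : C),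
      (PowerSeries.X ^ l : PowerSeries ℚ) • b - (d + x) β ∈ ⨆ j ≥ (0 : ℤ), 𝒞 j ∧
      (d + x) ((PowerSeries.X ^ l : PowerSeries ℚ) • b - (d + x) β) = 0 := by
  obtain ⟨l, β, hβ⟩ := gradingFiltration.exists_pow_smul_sub_mem_zero
    hinternal.submodule_iSupIndep hd hx hsq htor n hb hcycle
  refine ⟨l, β, hβ, ?_⟩
  rw [map_sub, map_smul, hcycle, smul_zero, ← LinearMap.comp_apply, hsq,
    LinearMap.zero_apply, sub_zero]
end

section
/- Suppose a, b ∈ F⁰, M ∈ ℕ, n ≥ 2, and c ∈ F^{−n} satisfy a = λ^M·b + d♯(c). Then there exist l ∈ ℕ and c′ ∈ F^{−1} such that λ^l·a = λ^{M+l}·b + d♯(c′). -/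
section GradedFiltration

variable {R C : Type*} [CommRing R] [AddCommGroup C] [Module R C] {𝒞 : ℤ → Submodule R C}

theorem filtration_antitone {i k : ℤ} (h : i ≤ k) : ⨆ j ≥ k, 𝒞 j ≤ ⨆ j ≥ i, 𝒞 j :=
  biSup_mono fun _ hj => h.trans hj

theorem grade_le_filtration {i k : ℤ} (h : i ≤ k) : 𝒞 k ≤ ⨆ j ≥ i, 𝒞 j :=
  le_iSup₂_of_le k h le_rfl

/-- A linear map raising the grading by at least `k` raises the filtration level by `k`. -/
theorem map_mem_filtration {f : C →ₗ[R] C} {k : ℤ}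
    (hf : ∀ h : ℤ, ∀ z ∈ 𝒞 h, f z ∈ ⨆ j ≥ h + k, 𝒞 j) {i : ℤ} {z : C}
    (hz : z ∈ ⨆ j ≥ i, 𝒞 j) : f z ∈ ⨆ j ≥ i + k, 𝒞 j := by
  have hle : ⨆ j ≥ i, 𝒞 j ≤ (⨆ j ≥ i + k, 𝒞 j).comap f :=
    iSup₂_le fun h hi w hw => filtration_antitone (add_le_add_left hi k) (hf h w hw)
  exact hle hz

theorem exists_add_of_mem_filtration {i : ℤ} {z : C} (hz : z ∈ ⨆ j ≥ i, 𝒞 j) :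
    ∃ u ∈ 𝒞 i, ∃ v ∈ ⨆ j ≥ i + 1, 𝒞 j, u + v = z := by
  have hle : ⨆ j ≥ i, 𝒞 j ≤ 𝒞 i ⊔ ⨆ j ≥ i + 1, 𝒞 j := by
    refine iSup₂_le fun j hj => ?_
    rcases eq_or_lt_of_le hj with rfl | hlt
    · exact le_sup_left
    · exact le_sup_of_le_right (grade_le_filtration hlt)
  exact Submodule.mem_sup.mp (hle hz)

theorem eq_zero_of_mem_grade_of_mem_filtration (hind : iSupIndep 𝒞) {i k : ℤ} (hik : i < k)
    {z : C} (hz : z ∈ 𝒞 i) (hz' : z ∈ ⨆ j ≥ k, 𝒞 j) : z = 0 := by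
  have hle : ⨆ j ≥ k, 𝒞 j ≤ ⨆ j ≠ i, 𝒞 j :=
    biSup_mono fun _ hj => (hik.trans_le hj).ne'
  exact Submodule.disjoint_def.mp (hind i) z hz (hle hz')

/-- If `d♯ c` lies two filtration levels above `c`, and cycles of `d` in the lowest grading of `c`
are `r`-power torsion in homology, then after multiplying by a power of `r` the chain `c` can be
moved up one filtration level without changing its image under `d♯`. -/
theorem exists_chain_in_next_filtration (hind : iSupIndep 𝒞) (r : R) {d x : C →ₗ[R] C}
    (hd : ∀ h : ℤ, ∀ z ∈ 𝒞 h, d z ∈ 𝒞 (h + 1))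
    (hx : ∀ h : ℤ, ∀ z ∈ 𝒞 h, x z ∈ ⨆ j ≥ h + 2, 𝒞 j)
    (hsq : (d + x) ∘ₗ (d + x) = 0) {h : ℤ}
    (htor : ∀ z ∈ 𝒞 h, d z = 0 → ∃ (l : ℕ) (β : C), β ∈ 𝒞 (h - 1) ∧ r ^ l • z = d β)
    {c : C} (hc : c ∈ ⨆ j ≥ h, 𝒞 j) (hdc : (d + x) c ∈ ⨆ j ≥ h + 2, 𝒞 j) :
    ∃ (l : ℕ) (c' : C), c' ∈ ⨆ j ≥ h + 1, 𝒞 j ∧ (d + x) c' = r ^ l • (d + x) c := by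
  obtain ⟨u, hu, v, hv, rfl⟩ := exists_add_of_mem_filtration hc
  have hdv : d v ∈ ⨆ j ≥ h + 2, 𝒞 j := by
    have := map_mem_filtration (fun i z hz => grade_le_filtration le_rfl (hd i z hz)) hv
    rwa [add_assoc, one_add_one_eq_two] at this
  have hdu : d u = 0 := by
    refine eq_zero_of_mem_grade_of_mem_filtration hind (k := h + 2) (by lia) (hd h u hu) ?_
    have hdecomp : d u = (d + x) (u + v) - d v - x (u + v) := by
      simp only [LinearMap.add_apply, map_add]; abel
    rw [hdecomp]
    exact sub_mem (sub_mem hdc hdv) (map_mem_filtration hx hc)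
  obtain ⟨l, β, hβ, hl⟩ := htor u hu hdu
  refine ⟨l, r ^ l • v - x β, sub_mem (Submodule.smul_mem _ _ hv) ?_, ?_⟩
  · exact filtration_antitone (by lia) (hx _ β hβ)
  · have hcorr : r ^ l • v - x β = r ^ l • (u + v) - (d + x) β := by
      rw [smul_add, hl, LinearMap.add_apply]; abel
    have hββ : (d + x) ((d + x) β) = 0 := LinearMap.congr_fun hsq β
    rw [hcorr, map_sub, hββ, sub_zero, map_smul]

/-- Iterating `exists_chain_in_next_filtration` moves a chain whose image under `d♯` lies in
filtration level `0` into filtration level `-1`. -/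
theorem exists_chain_in_filtration_neg_one (hind : iSupIndep 𝒞) (r : R) {d x : C →ₗ[R] C}
    (hd : ∀ h : ℤ, ∀ z ∈ 𝒞 h, d z ∈ 𝒞 (h + 1))
    (hx : ∀ h : ℤ, ∀ z ∈ 𝒞 h, x z ∈ ⨆ j ≥ h + 2, 𝒞 j)
    (hsq : (d + x) ∘ₗ (d + x) = 0)
    (htor : ∀ h : ℤ, h < 0 → ∀ z ∈ 𝒞 h, d z = 0 →
      ∃ (l : ℕ) (β : C), β ∈ 𝒞 (h - 1) ∧ r ^ l • z = d β)
    (k : ℕ) {c : C} (hc : c ∈ ⨆ j ≥ -1 - (k : ℤ), 𝒞 j)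
    (hdc : (d + x) c ∈ ⨆ j ≥ (0 : ℤ), 𝒞 j) :
    ∃ (l : ℕ) (c' : C), c' ∈ ⨆ j ≥ (-1 : ℤ), 𝒞 j ∧ (d + x) c' = r ^ l • (d + x) c := by
  induction k generalizing c with
  | zero => exact ⟨0, c, by simpa using hc, by simp⟩
  | succ k ih =>
    obtain ⟨l, c₁, hc₁, hl⟩ := exists_chain_in_next_filtration hind r hd hx hsq
      (htor _ (by lia)) hc (filtration_antitone (by lia) hdc)
    obtain ⟨m, c₂, hc₂, hm⟩ := ih (filtration_antitone (by lia) hc₁)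
      (hl ▸ Submodule.smul_mem _ _ hdc)
    exact ⟨m + l, c₂, hc₂, by rw [hm, hl, smul_smul, pow_add]⟩

end GradedFiltration

/-- Let `C = ⊕ₕ Cₕ` be a ℤ-graded module over `R = ℚ[[λ]]`, `d` homogeneous of degree `+1`,
`x` raising the grading by at least `2`, `d♯ = d + x` with `d♯ ∘ d♯ = 0`, and suppose the
`d`-homology in negative gradings is `λ`-power torsion.  If `a, b ∈ F⁰`, `M ∈ ℕ`, `n ≥ 2`,
and `c ∈ F^{-n}` satisfy `a = λ^M·b + d♯(c)`, then there exist `l ∈ ℕ` and `c′ ∈ F^{-1}`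
with `λ^l·a = λ^{M+l}·b + d♯(c′)`. -/
theorem chain_moves_into_filtration_level_minus_one
    {C : Type*} [AddCommGroup C] [Module (PowerSeries ℚ) C]
    (𝒞 : ℤ → Submodule (PowerSeries ℚ) C)
    (hinternal : DirectSum.IsInternal 𝒞)
    (d x : C →ₗ[PowerSeries ℚ] C)
    (hd : ∀ h : ℤ, ∀ z ∈ 𝒞 h, d z ∈ 𝒞 (h + 1))
    (hx : ∀ h : ℤ, ∀ z ∈ 𝒞 h, x z ∈ ⨆ j ≥ h + 2, 𝒞 j)
    (hsq : (d + x) ∘ₗ (d + x) = 0)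
    (htor : ∀ h : ℤ, h < 0 → ∀ z ∈ 𝒞 h, d z = 0 →
      ∃ (l : ℕ) (β : C), β ∈ 𝒞 (h - 1) ∧ (PowerSeries.X ^ l : PowerSeries ℚ) • z = d β)
    (a b : C) (ha : a ∈ ⨆ j ≥ (0 : ℤ), 𝒞 j) (hbF : b ∈ ⨆ j ≥ (0 : ℤ), 𝒞 j)
    (M : ℕ) (n : ℕ) (hn : 2 ≤ n) (c : C) (hc : c ∈ ⨆ j ≥ -(n : ℤ), 𝒞 j)
    (heq : a = (PowerSeries.X ^ M : PowerSeries ℚ) • b + (d + x) c) :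
    ∃ (l : ℕ) (c' : C), c' ∈ ⨆ j ≥ (-1 : ℤ), 𝒞 j ∧
      (PowerSeries.X ^ l : PowerSeries ℚ) • a =
        (PowerSeries.X ^ (M + l) : PowerSeries ℚ) • b + (d + x) c' := by
  have hdc : (d + x) c ∈ ⨆ j ≥ (0 : ℤ), 𝒞 j := by
    rw [← sub_eq_of_eq_add' heq]
    exact sub_mem ha (Submodule.smul_mem _ _ hbF)
  obtain ⟨l, c', hc', hl⟩ := exists_chain_in_filtration_neg_one hinternal.submodule_iSupIndep
    PowerSeries.X hd hx hsq htor n (filtration_antitone (by lia) hc) hdc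
  exact ⟨l, c', hc', by rw [hl, heq, smul_add, smul_smul, ← pow_add, add_comm l M]⟩
end

section
/- Let R = ℚ[[λ]], let M be a finitely generated R-module with torsion submodule T, and let π : M → M/T be the quotient map. For x ∈ M and m ∈ ℕ, the following are equivalent: (i) π(x) ∈ λ^m·(M/T); (ii) there exists N ∈ ℕ such that for all k ≥ N, λ^k·x ∈ λ^{k+m}·M. -/
/-- An element of a module over `k⟦X⟧` is torsion if and only if it is killed by a power of `X`. -/
theorem PowerSeries.mem_torsion_iff_exists_X_pow_smul_eq_zero {k M : Type*} [Field k]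
    [AddCommGroup M] [Module (PowerSeries k) M] {x : M} :
    x ∈ Submodule.torsion (PowerSeries k) M ↔
      ∃ n : ℕ, (PowerSeries.X ^ n : PowerSeries k) • x = 0 := by
  rw [Submodule.mem_torsion_iff]
  constructor
  · rintro ⟨⟨r, hr⟩, hrx⟩
    have hr0 : r ≠ 0 := nonZeroDivisors.ne_zero hr
    obtain ⟨u, hu⟩ := PowerSeries.isUnit_divided_by_X_pow_order hr0
    refine ⟨r.order.toNat, ?_⟩
    replace hrx : r • x = 0 := hrx
    rwa [← PowerSeries.X_pow_order_mul_divXPowOrder (f := r), ← hu, mul_comm, mul_smul,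
      ← Units.smul_def, smul_eq_zero_iff_eq] at hrx
  · rintro ⟨n, hn⟩
    exact ⟨⟨_, mem_nonZeroDivisors_of_ne_zero (pow_ne_zero n PowerSeries.X_ne_zero)⟩, hn⟩


/-- For a finitely generated module `M` over `R = ℚ[[λ]]` with torsion submodule `T` and
quotient map `π : M → M/T`, and for `x ∈ M`, `m ∈ ℕ`, the following are equivalent:
(i) `π(x) ∈ λ^m·(M/T)`; (ii) there is `N` such that for all `k ≥ N`,
`λ^k·x ∈ λ^{k+m}·M`. -/
theorem divisibility_mod_torsion_iff_eventual_divisibility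
    {M : Type*} [AddCommGroup M] [Module (PowerSeries ℚ) M]
    [Module.Finite (PowerSeries ℚ) M] (x : M) (m : ℕ) :
    (∃ y : M ⧸ Submodule.torsion (PowerSeries ℚ) M,
        (Submodule.Quotient.mk x : M ⧸ Submodule.torsion (PowerSeries ℚ) M) =
          (PowerSeries.X ^ m : PowerSeries ℚ) • y) ↔
    (∃ N : ℕ, ∀ k : ℕ, N ≤ k → ∃ z : M,
        (PowerSeries.X ^ k : PowerSeries ℚ) • x =
          (PowerSeries.X ^ (k + m) : PowerSeries ℚ) • z) := by
  constructor
  · rintro ⟨y, hy⟩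
    obtain ⟨z, rfl⟩ := Submodule.Quotient.mk_surjective _ y
    rw [← Submodule.Quotient.mk_smul, Submodule.Quotient.eq,
      PowerSeries.mem_torsion_iff_exists_X_pow_smul_eq_zero] at hy
    obtain ⟨n, hn⟩ := hy
    refine ⟨n, fun k hk => ⟨z, ?_⟩⟩
    obtain ⟨j, rfl⟩ := Nat.exists_eq_add_of_le' hk
    rw [← sub_eq_zero, pow_add _ (j + n) m, mul_smul, ← smul_sub, pow_add, mul_smul, hn,
      smul_zero]
  · rintro ⟨N, h⟩
    obtain ⟨z, hz⟩ := h N le_rfl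
    refine ⟨Submodule.Quotient.mk z, ?_⟩
    rw [← Submodule.Quotient.mk_smul, Submodule.Quotient.eq,
      PowerSeries.mem_torsion_iff_exists_X_pow_smul_eq_zero]
    exact ⟨N, by rw [smul_sub, hz, pow_add, mul_smul, sub_self]⟩
end
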